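/- Let B be an nbc-base of 𝒜, regarded as a standard ordered tuple, and order the standard ordered nbc-bases lexicographically (≺). Then B is a homology facet of the lexicographic shelling of the broken circuit complex — i.e. for every H ∈ B there exists an nbc-base B' with B ∖ {H} ⊆ B' and B' ≺ B — if and only if B is a βnbc-base. -/

import Mathlib

open Module

noncomputable section

/-- An arrangement of `n` (affine) hyperplanes inside the ambient affine subspace `amb`
of the complex vector space `W`.  The linear order on the hyperplanes is the order of the
indices in `Fin n`; an arbitrary linear order is encoded by a permutation `σ` of `Fin n`,
with `i ≺ j ↔ σ i < σ j`. -/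
structure HArr (W : Type) [AddCommGroup W] [Module ℂ W] (n : ℕ) where
  amb : AffineSubspace ℂ W
  amb_ne : (amb : Set W).Nonempty
  H : Fin n → AffineSubspace ℂ W
  inj : Function.Injective H
  le_amb : ∀ i, H i ≤ amb
  nonemptyH : ∀ i, ((H i : Set W)).Nonempty
  hyp : ∀ i, finrank ℂ (H i).direction + 1 = finrank ℂ amb.direction

namespace HArr

variable {W : Type} [AddCommGroup W] [Module ℂ W] {n : ℕ}

/-- The intersection `⋂ S` of a subset of the arrangement (the ambient space for `S = ∅`). -/
def inter (A : HArr W n) (S : Finset (Fin n)) : AffineSubspace ℂ W :=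
  A.amb ⊓ S.inf A.H

/-- Codimension (inside the ambient space) of an affine subspace. -/
def cd (A : HArr W n) (X : AffineSubspace ℂ W) : ℕ :=
  finrank ℂ A.amb.direction - finrank ℂ X.direction

/-- A dependent subset of the arrangement. -/
def dep (A : HArr W n) (S : Finset (Fin n)) : Prop :=
  A.inter S ≠ ⊥ ∧ A.cd (A.inter S) < S.card

/-- An independent subset of the arrangement. -/
def indep (A : HArr W n) (S : Finset (Fin n)) : Prop :=
  A.inter S ≠ ⊥ ∧ A.cd (A.inter S) = S.card

/-- A base: a maximal independent subset. -/
def isBase (A : HArr W n) (S : Finset (Fin n)) : Prop :=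
  A.indep S ∧ ∀ T, A.indep T → S ⊆ T → S = T

open scoped Classical in
/-- The rank of a subarrangement `{H i : i ∈ C}`. -/
def rankOn (A : HArr W n) (C : Finset (Fin n)) : ℕ :=
  C.powerset.sup fun S => if A.indep S then S.card else 0

/-- The rank `r` of the arrangement. -/
def rank (A : HArr W n) : ℕ := A.rankOn Finset.univ

/-- A circuit: an inclusion-minimal dependent set. -/
def circuit (A : HArr W n) (S : Finset (Fin n)) : Prop :=
  A.dep S ∧ ∀ T ⊂ S, ¬ A.dep T

/-- A broken circuit w.r.t. the linear order given by `σ`. -/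
def brokenCircuit (A : HArr W n) (σ : Equiv.Perm (Fin n)) (S : Finset (Fin n)) : Prop :=
  ∃ i ∉ S, (∀ j ∈ S, σ i < σ j) ∧ A.circuit (insert i S)

/-- An nbc set: nonempty intersection and containing no broken circuit. -/
def nbcSet (A : HArr W n) (σ : Equiv.Perm (Fin n)) (S : Finset (Fin n)) : Prop :=
  A.inter S ≠ ⊥ ∧ ∀ T ⊆ S, ¬ A.brokenCircuit σ T

/-- An nbc-base. -/
def nbcBase (A : HArr W n) (σ : Equiv.Perm (Fin n)) (S : Finset (Fin n)) : Prop :=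
  A.nbcSet σ S ∧ A.isBase S

/-- A βnbc-base. -/
def betaNbcBase (A : HArr W n) (σ : Equiv.Perm (Fin n)) (S : Finset (Fin n)) : Prop :=
  A.nbcBase σ S ∧ ∀ i ∈ S, ∃ j, σ j < σ i ∧ A.isBase (insert j (S.erase i))

/-- Membership in the intersection poset `L(𝒜)`. -/
def memL (A : HArr W n) (X : AffineSubspace ℂ W) : Prop :=
  X ≠ ⊥ ∧ ∃ S : Finset (Fin n), A.inter S = X

/-- A maximal element of `L(𝒜)` (in the reverse-inclusion order). -/
def maximalL (A : HArr W n) (X : AffineSubspace ℂ W) : Prop :=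
  A.memL X ∧ ∀ Y, A.memL Y → Y ≤ X → Y = X

open scoped Classical in
/-- The set of indices of hyperplanes containing `X`, i.e. `𝒜_X`. -/
def sub (A : HArr W n) (X : AffineSubspace ℂ W) : Finset (Fin n) :=
  Finset.univ.filter fun i => X ≤ A.H i

/-- `X` is dense: `𝒜_X` admits no decomposition into two nonempty parts. -/
def denseL (A : HArr W n) (X : AffineSubspace ℂ W) : Prop :=
  ¬ ∃ S T : Finset (Fin n), Disjoint S T ∧ S.Nonempty ∧ T.Nonempty ∧
      S ∪ T = A.sub X ∧ A.cd (A.inter S) + A.cd (A.inter T) = A.cd X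

/-- `i` is the minimum of `S` w.r.t. the linear order given by `σ`. -/
def isMin (σ : Equiv.Perm (Fin n)) (i : Fin n) (S : Finset (Fin n)) : Prop :=
  i ∈ S ∧ ∀ j ∈ S, σ i ≤ σ j

/-- The standard ordered tuple of a finite set, w.r.t. the linear order given by `σ`:
`tup σ S p` is the element of `S` with `(p+1)`-st smallest `σ`-value. -/
def tup (σ : Equiv.Perm (Fin n)) (S : Finset (Fin n)) (p : Fin S.card) : Fin n :=
  σ.symm (((S.image ⇑σ).orderIsoOfFin (Finset.card_image_of_injective S σ.injective) p).1)

/-- The flag `ξ(B) = (X_1 > ⋯ > X_r)` of a standard ordered base: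
`flag σ S p = X_{p+1} = ⋂_{k ≥ p} H_{i_k}`. -/
def flag (A : HArr W n) (σ : Equiv.Perm (Fin n)) (S : Finset (Fin n)) (p : Fin S.card) :
    AffineSubspace ℂ W :=
  A.inter (S.filter fun i => σ (tup σ S p) ≤ σ i)

/-- Lexicographic order on standard ordered tuples (for the canonical order). -/
def lexLt (S T : Finset (Fin n)) : Prop :=
  List.Lex (· < ·) (S.sort (· ≤ ·)) (T.sort (· ≤ ·))

/-- `λ(X) = Σ_{H_i ∈ 𝒜_X} λ_i`. -/
def lamX (A : HArr W n) (lam : Fin n → ℂ) (X : AffineSubspace ℂ W) : ℂ :=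
  ∑ i ∈ A.sub X, lam i

/-- `X` is unmixed (w.r.t. the order `σ`). -/
def unmixedX (A : HArr W n) (σ : Equiv.Perm (Fin n)) (X : AffineSubspace ℂ W) : Prop :=
  (∀ S, A.nbcBase σ S → A.inter S = X → A.betaNbcBase σ S) ∨
  (∀ S, A.nbcBase σ S → A.inter S = X → ¬ A.betaNbcBase σ S)

/-- The linear order given by `σ` is unmixed. -/
def unmixedOrd (A : HArr W n) (σ : Equiv.Perm (Fin n)) : Prop :=
  ∀ X, A.maximalL X → A.unmixedX σ X

/-- Membership in the intersection poset of the deleted arrangement `𝒜 ∖ {H_{i₀}}`. -/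
def memLdel (A : HArr W n) (i₀ : Fin n) (X : AffineSubspace ℂ W) : Prop :=
  X ≠ ⊥ ∧ ∃ S : Finset (Fin n), i₀ ∉ S ∧ A.inter S = X

/-- A maximal element of the intersection poset of the deleted arrangement. -/
def maximalLdel (A : HArr W n) (i₀ : Fin n) (X : AffineSubspace ℂ W) : Prop :=
  A.memLdel i₀ X ∧ ∀ Y, A.memLdel i₀ Y → Y ≤ X → Y = X

/-- The generator `e_i` of the exterior algebra `E`. -/
def gen (i : Fin n) : ExteriorAlgebra ℂ (Fin n → ℂ) :=
  ExteriorAlgebra.ι ℂ (Pi.single i 1)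

/-- `e_S = e_{i_1} ∧ ⋯ ∧ e_{i_p}` for `S = {i_1 < ⋯ < i_p}`. -/
def eS (S : Finset (Fin n)) : ExteriorAlgebra ℂ (Fin n → ℂ) :=
  ((S.sort (· ≤ ·)).map gen).prod

/-- `∂e_S = Σ_k (−1)^{k−1} e_{S ∖ {i_k}}`. -/
def bdry (S : Finset (Fin n)) : ExteriorAlgebra ℂ (Fin n → ℂ) :=
  ∑ i ∈ S, ((-1 : ℂ) ^ (S.filter fun j => j < i).card) • eS (S.erase i)

/-- The defining relations of the Orlik–Solomon algebra. -/
inductive OSRel (A : HArr W n) :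
    ExteriorAlgebra ℂ (Fin n → ℂ) → ExteriorAlgebra ℂ (Fin n → ℂ) → Prop
  | isBot : ∀ S : Finset (Fin n), A.inter S = ⊥ → OSRel A (eS S) 0
  | isDep : ∀ S : Finset (Fin n), A.dep S → OSRel A (bdry S) 0

/-- The Orlik–Solomon algebra `A(𝒜)`: the exterior algebra modulo the ideal generated by
the `e_S` with empty intersection and the `∂e_S` with `S` dependent. -/
abbrev OS (A : HArr W n) := RingQuot (OSRel A)

/-- The quotient map `E → A(𝒜)`. -/
def osMk (A : HArr W n) : ExteriorAlgebra ℂ (Fin n → ℂ) →ₐ[ℂ] OS A :=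
  RingQuot.mkAlgHom ℂ (OSRel A)

/-- `ω_i`, the image of `e_i` in the Orlik–Solomon algebra. -/
def om (A : HArr W n) (i : Fin n) : OS A := osMk A (gen i)

/-- `ω_B`, the image of `e_B` in the Orlik–Solomon algebra. -/
def omB (A : HArr W n) (S : Finset (Fin n)) : OS A := osMk A (eS S)

/-- The degree `p` part `A^p` of the Orlik–Solomon algebra. -/
def deg (A : HArr W n) (p : ℕ) : Submodule ℂ (OS A) :=
  Submodule.span ℂ {x | ∃ S : Finset (Fin n), S.card = p ∧ x = omB A S}

/-- `ω_λ = Σ_i λ_i ω_i`. -/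
def omLam (A : HArr W n) (lam : Fin n → ℂ) : OS A := ∑ i, lam i • om A i

/-- `ω_λ(X) = Σ_{H_i ∈ 𝒜_X} λ_i ω_i`. -/
def omLamX (A : HArr W n) (lam : Fin n → ℂ) (X : AffineSubspace ℂ W) : OS A :=
  ∑ i ∈ A.sub X, lam i • om A i

/-- The form `Ξ(B) = ω_λ(X_1) ⋯ ω_λ(X_r)` attached to a standard ordered base. -/
def Xi (A : HArr W n) (σ : Equiv.Perm (Fin n)) (lam : Fin n → ℂ) (S : Finset (Fin n)) :
    OS A :=
  ((List.finRange S.card).map fun p => A.omLamX lam (A.flag σ S p)).prod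

/-- The submodule `ω_λ ∧ A^p` of the Orlik-Solomon algebra. -/
def Ideg (A : HArr W n) (lam : Fin n → ℂ) (p : ℕ) : Submodule ℂ (OS A) :=
  (A.deg p).map (LinearMap.mulLeft ℂ (A.omLam lam))

end HArr

namespace HArr

variable {W : Type} [AddCommGroup W] [Module ℂ W] {n : ℕ} (A : HArr W n)

lemma inter_insert (i : Fin n) (S : Finset (Fin n)) :
    A.inter (insert i S) = A.inter S ⊓ A.H i := by
  unfold inter
  rw [Finset.inf_insert, inf_comm (A.H i), inf_assoc]

lemma inter_anti {S T : Finset (Fin n)} (h : S ⊆ T) : A.inter T ≤ A.inter S :=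
  inf_le_inf_left _ (Finset.inf_mono h)

lemma inter_le_amb (S : Finset (Fin n)) : A.inter S ≤ A.amb := inf_le_left

lemma inter_le_H {i : Fin n} {S : Finset (Fin n)} (h : i ∈ S) : A.inter S ≤ A.H i :=
  inf_le_right.trans (Finset.inf_le h)

lemma inter_insert_of_le {i : Fin n} {S : Finset (Fin n)} (h : A.inter S ≤ A.H i) :
    A.inter (insert i S) = A.inter S := by
  rw [inter_insert, inf_eq_left.2 h]

variable [FiniteDimensional ℂ W]

lemma finrank_inter_le_amb (S : Finset (Fin n)) :
    finrank ℂ (A.inter S).direction ≤ finrank ℂ A.amb.direction :=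
  Submodule.finrank_mono (AffineSubspace.direction_le (A.inter_le_amb S))

/-- Meeting with a hyperplane drops the dimension by at most one. -/
lemma finrank_le_inf_H {X : AffineSubspace ℂ W} (hX : X ≤ A.amb) (i : Fin n)
    (hne : X ⊓ A.H i ≠ ⊥) :
    finrank ℂ X.direction ≤ finrank ℂ (X ⊓ A.H i).direction + 1 := by
  obtain ⟨p, hp⟩ := AffineSubspace.nonempty_iff_ne_bot _ |>.2 hne
  rw [AffineSubspace.direction_inf_of_mem hp.1 hp.2]
  have h1 := Submodule.finrank_sup_add_finrank_inf_eq X.direction (A.H i).direction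
  have h2 : finrank ℂ ↥(X.direction ⊔ (A.H i).direction) ≤ finrank ℂ A.amb.direction :=
    Submodule.finrank_mono (sup_le (AffineSubspace.direction_le hX)
      (AffineSubspace.direction_le (A.le_amb i)))
  have h3 := A.hyp i
  omega

lemma cd_inter_le_card (S : Finset (Fin n)) (hS : A.inter S ≠ ⊥) :
    A.cd (A.inter S) ≤ S.card := by
  induction S using Finset.induction_on with
  | empty =>
    have h : A.inter ∅ = A.amb := by rw [inter, Finset.inf_empty, inf_top_eq]
    rw [h, cd, Nat.sub_self]
    exact Nat.zero_le _
  | insert i S hi ih =>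
    have hS' : A.inter S ≠ ⊥ := fun h => hS (by rw [inter_insert, h, bot_inf_eq])
    have h1 := ih hS'
    rw [inter_insert] at hS ⊢
    have h2 := A.finrank_le_inf_H (A.inter_le_amb S) i hS
    rw [Finset.card_insert_of_notMem hi]
    unfold cd at *
    omega

/-- A subspace missing the hyperplane `H i` is parallel to it. -/
lemma direction_le_of_inf_eq_bot {X : AffineSubspace ℂ W} (hX : X ≤ A.amb) (hX0 : X ≠ ⊥)
    (i : Fin n) (h : X ⊓ A.H i = ⊥) : X.direction ≤ (A.H i).direction := by
  by_contra hle
  obtain ⟨x, hx⟩ := AffineSubspace.nonempty_iff_ne_bot _ |>.2 hX0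
  obtain ⟨y, hy⟩ := A.nonemptyH i
  have hsup : X.direction ⊔ (A.H i).direction = A.amb.direction := by
    refine Submodule.eq_of_le_of_finrank_le (sup_le (AffineSubspace.direction_le hX)
      (AffineSubspace.direction_le (A.le_amb i))) ?_
    have hlt : (A.H i).direction < X.direction ⊔ (A.H i).direction :=
      lt_of_le_of_ne le_sup_right fun he => hle (he ▸ le_sup_left)
    have := Submodule.finrank_lt_finrank_of_lt hlt
    have := A.hyp i
    omega
  have hxy : x -ᵥ y ∈ A.amb.direction :=
    AffineSubspace.vsub_mem_direction (hX hx) (A.le_amb i hy)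
  rw [← hsup] at hxy
  obtain ⟨u, hu, v, hv, huv⟩ := Submodule.mem_sup.1 hxy
  have h1 : -u +ᵥ x ∈ X :=
    AffineSubspace.vadd_mem_of_mem_direction (Submodule.neg_mem _ hu) hx
  have h2 : v +ᵥ y ∈ A.H i := AffineSubspace.vadd_mem_of_mem_direction hv hy
  have h3 : -u +ᵥ x = v +ᵥ y := by
    simp only [vadd_eq_add, vsub_eq_sub] at *
    rw [eq_sub_iff_add_eq] at huv
    rw [← huv]; abel
  have h4 : -u +ᵥ x ∈ X ⊓ A.H i := ⟨h1, h3 ▸ h2⟩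
  rw [h] at h4
  exact AffineSubspace.notMem_bot ℂ W _ h4

lemma isBase.direction_le {S : Finset (Fin n)} (hS : A.isBase S) (i : Fin n) :
    (A.inter S).direction ≤ (A.H i).direction := by
  by_cases h : A.inter S ⊓ A.H i = ⊥
  · exact A.direction_le_of_inf_eq_bot (A.inter_le_amb S) hS.1.1 i h
  by_cases hle : A.inter S ≤ A.H i
  · exact AffineSubspace.direction_le hle
  exfalso
  have hi : i ∉ S := fun hi => hle (A.inter_le_H hi)
  have hind : A.indep (insert i S) := by
    refine ⟨by rwa [inter_insert], ?_⟩
    rw [inter_insert, Finset.card_insert_of_notMem hi, ← hS.1.2]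
    have h1 := A.finrank_le_inf_H (A.inter_le_amb S) i h
    have h2 := Submodule.finrank_lt_finrank_of_lt
      (AffineSubspace.direction_lt_of_nonempty (inf_lt_left.2 hle)
        (AffineSubspace.nonempty_iff_ne_bot _ |>.2 h))
    have h3 := A.finrank_inter_le_amb S
    unfold cd
    omega
  have := hS.2 _ hind (Finset.subset_insert i S)
  exact hi (this ▸ Finset.mem_insert_self i S)

lemma isBase.direction_le_inter {S : Finset (Fin n)} (hS : A.isBase S) (T : Finset (Fin n))
    (hT : A.inter T ≠ ⊥) : (A.inter S).direction ≤ (A.inter T).direction := by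
  induction T using Finset.induction_on with
  | empty => exact AffineSubspace.direction_le (A.inter_anti (Finset.empty_subset S))
  | insert i T hi ih =>
    have hT' : A.inter T ≠ ⊥ := fun h => hT (by rw [inter_insert, h, bot_inf_eq])
    rw [inter_insert] at hT ⊢
    obtain ⟨p, hp⟩ := AffineSubspace.nonempty_iff_ne_bot _ |>.2 hT
    rw [AffineSubspace.direction_inf_of_mem hp.1 hp.2]
    exact le_inf (ih hT') (hS.direction_le A i)

lemma indep.card_le_of_isBase {S T : Finset (Fin n)} (hT : A.indep T) (hS : A.isBase S) :
    T.card ≤ S.card := by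
  have h := Submodule.finrank_mono (hS.direction_le_inter A T hT.1)
  rw [← hT.2, ← hS.1.2]
  exact Nat.sub_le_sub_left h _

lemma isBase.card_eq {S T : Finset (Fin n)} (hS : A.isBase S) (hT : A.isBase T) :
    S.card = T.card :=
  le_antisymm (hS.1.card_le_of_isBase A hT) (hT.1.card_le_of_isBase A hS)

lemma indep.isBase_of_card_eq {S T : Finset (Fin n)} (hT : A.indep T) (hS : A.isBase S)
    (h : T.card = S.card) : A.isBase T :=
  ⟨hT, fun _ hU hTU => Finset.eq_of_subset_of_card_le hTU (h ▸ hU.card_le_of_isBase A hS)⟩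

/-- Every element of a circuit contains the intersection of the others. -/
lemma circuit.inter_erase_le {C : Finset (Fin n)} (hC : A.circuit C) {i : Fin n} (hi : i ∈ C) :
    A.inter (C.erase i) ≤ A.H i := by
  have hle : A.inter C ≤ A.inter (C.erase i) := A.inter_anti (Finset.erase_subset i C)
  have hne : A.inter (C.erase i) ≠ ⊥ := fun h => hC.1.1 (le_bot_iff.1 (h ▸ hle))
  have hnd := hC.2 _ (Finset.erase_ssubset hi)
  have h1 : (C.erase i).card ≤ A.cd (A.inter (C.erase i)) :=
    not_lt.1 fun h => hnd ⟨hne, h⟩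
  have h2 := hC.1.2
  have h3 := Finset.card_erase_add_one hi
  have h4 := A.finrank_inter_le_amb (C.erase i)
  have hdir : (A.inter C).direction = (A.inter (C.erase i)).direction := by
    refine Submodule.eq_of_le_of_finrank_le (AffineSubspace.direction_le hle) ?_
    unfold cd at h1 h2
    omega
  rw [← AffineSubspace.eq_of_direction_eq_of_nonempty_of_le hdir
    (AffineSubspace.nonempty_iff_ne_bot _ |>.2 hC.1.1) hle]
  exact A.inter_le_H hi

lemma indep.not_circuit_of_subset {S C : Finset (Fin n)} (hS : A.indep S) (hCS : C ⊆ S) :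
    ¬ A.circuit C := by
  intro hC
  have hCne : C.Nonempty := Finset.card_pos.1 (by have := hC.1.2; omega)
  obtain ⟨i, hi⟩ := hCne
  have hle : A.inter (S.erase i) ≤ A.H i :=
    (A.inter_anti (Finset.erase_subset_erase i hCS)).trans (hC.inter_erase_le A hi)
  have he : A.inter S = A.inter (S.erase i) := by
    rw [← A.inter_insert_of_le hle, Finset.insert_erase (hCS hi)]
  have h1 := A.cd_inter_le_card (S.erase i) (he ▸ hS.1)
  rw [← he, hS.2] at h1
  have := Finset.card_erase_add_one (hCS hi)
  omega

/-- Exchange along a broken circuit: replacing an element of an independent set by the smaller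
element completing a broken circuit through it keeps the set independent. -/
lemma indep.exchange {C T : Finset (Fin n)} {j g : Fin n} (hj : j ∉ C)
    (hS : A.indep (insert j C)) (hT : T ⊆ insert j C) (hjT : j ∈ T) (hg : g ∉ T)
    (hcirc : A.circuit (insert g T)) : g ∉ C ∧ A.indep (insert g C) := by
  have hgj : g ≠ j := fun h => hg (h ▸ hjT)
  have hgC : g ∉ C := fun h => hS.not_circuit_of_subset A
    (Finset.insert_subset (Finset.mem_insert_of_mem h) hT) hcirc
  refine ⟨hgC, ?_⟩
  have hgle : A.inter (insert j C) ≤ A.H g := by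
    have := hcirc.inter_erase_le A (Finset.mem_insert_self g T)
    rw [Finset.erase_insert hg] at this
    exact (A.inter_anti hT).trans this
  have hjle : A.inter (insert g C) ≤ A.H j := by
    refine le_trans (A.inter_anti fun x hx => ?_)
      (hcirc.inter_erase_le A (Finset.mem_insert_of_mem hjT))
    have := @hT x
    simp only [Finset.mem_erase, Finset.mem_insert] at *
    tauto
  have he : A.inter (insert g C) = A.inter (insert j C) := by
    rw [← A.inter_insert_of_le hgle, ← A.inter_insert_of_le hjle, Finset.insert_comm]
  refine ⟨he ▸ hS.1, ?_⟩
  rw [he, hS.2, Finset.card_insert_of_notMem hj, Finset.card_insert_of_notMem hgC]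

lemma lex_orderedInsert {α : Type*} [LinearOrder α] {i j : α} (hji : j < i) (l : List α)
    (hj : j ∉ l) :
    List.Lex (· < ·) (l.orderedInsert (· ≤ ·) j) (l.orderedInsert (· ≤ ·) i) := by
  induction l with
  | nil => exact List.Lex.rel hji
  | cons b l ih =>
    rw [List.mem_cons, not_or] at hj
    simp only [List.orderedInsert_cons]
    by_cases h1 : j ≤ b
    · rw [if_pos h1]
      split_ifs
      · exact List.Lex.rel hji
      · exact List.Lex.rel (lt_of_le_of_ne h1 hj.1)
    · rw [if_neg h1, if_neg (fun h => h1 (hji.le.trans h))]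
      exact List.Lex.cons (ih hj.2)

lemma sort_insert_eq_orderedInsert {i : Fin n} {C : Finset (Fin n)} (hi : i ∉ C) :
    (insert i C).sort (· ≤ ·) = (C.sort (· ≤ ·)).orderedInsert (· ≤ ·) i := by
  refine List.Perm.eq_of_pairwise' (r := (· ≤ ·)) (Finset.pairwise_sort _ _)
    (List.Pairwise.orderedInsert _ _ (Finset.pairwise_sort _ _)) ?_
  refine List.Perm.trans ?_ (List.perm_orderedInsert _ _ _).symm
  rw [List.perm_ext_iff_of_nodup (Finset.sort_nodup _ _)
    (List.nodup_cons.2 ⟨by simpa using hi, Finset.sort_nodup _ _⟩)]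
  simp

lemma lexLt_insert {i j : Fin n} {C : Finset (Fin n)} (hi : i ∉ C) (hj : j ∉ C) (hji : j < i) :
    lexLt (insert j C) (insert i C) := by
  unfold lexLt
  rw [sort_insert_eq_orderedInsert hi, sort_insert_eq_orderedInsert hj]
  exact lex_orderedInsert hji _ (by simpa using hj)

lemma lexLt_insert_iff {i j : Fin n} {C : Finset (Fin n)} (hi : i ∉ C) (hj : j ∉ C) :
    lexLt (insert j C) (insert i C) ↔ j < i := by
  refine ⟨fun h => ?_, lexLt_insert hi hj⟩
  by_contra hle
  have hlt : (insert j C).sort (· ≤ ·) < (insert i C).sort (· ≤ ·) := h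
  rcases (not_lt.1 hle).eq_or_lt with rfl | hij
  · exact lt_irrefl _ hlt
  · have hgt : (insert i C).sort (· ≤ ·) < (insert j C).sort (· ≤ ·) := lexLt_insert hj hi hij
    exact lt_asymm hlt hgt

/-- If replacing `i` by a smaller element turns an nbc-base into a base, then the smallest such element
yields an nbc-base. -/
lemma exists_nbcBase_insert {B : Finset (Fin n)} {i j : Fin n} (hB : A.nbcBase 1 B) (hi : i ∈ B)
    (hji : j < i) (hj : A.isBase (insert j (B.erase i))) :
    ∃ k < i, k ∉ B.erase i ∧ A.nbcBase 1 (insert k (B.erase i)) := by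
  induction j using WellFoundedLT.induction with
  | ind j ih =>
    have hcard := hj.card_eq A hB.2
    have hcardB := Finset.card_erase_add_one hi
    have hjC : j ∉ B.erase i := fun h => by
      rw [Finset.insert_eq_of_mem h] at hcard
      omega
    by_cases hnbc : A.nbcSet 1 (insert j (B.erase i))
    · exact ⟨j, hji, hjC, hnbc, hj⟩
    have : ∃ T ⊆ insert j (B.erase i), A.brokenCircuit 1 T := by
      by_contra! h
      exact hnbc ⟨hj.1.1, h⟩
    obtain ⟨T, hT, hbr⟩ := this
    have hjT : j ∈ T := by
      by_contra hjT
      exact hB.1.2 T (((Finset.subset_insert_iff_of_notMem hjT).1 hT).trans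
        (Finset.erase_subset i B)) hbr
    obtain ⟨g, hgT, hmin, hcirc⟩ := hbr
    have hgj : g < j := hmin j hjT
    obtain ⟨hgC, hg⟩ := hj.1.exchange A hjC hT hjT hgT hcirc
    refine ih g hgj (hgj.trans hji) (hg.isBase_of_card_eq A hB.2 ?_)
    rw [Finset.card_insert_of_notMem hgC, hcardB]

end HArr

open scoped Classical
/-- An nbc-base is a homology facet of the lexicographic shelling of the
broken circuit complex iff it is a βnbc-base. -/
theorem homology_facet_iff_betaNbc {W : Type} [AddCommGroup W] [Module ℂ W]
    [FiniteDimensional ℂ W] {n : ℕ} (A : HArr W n) (B : Finset (Fin n))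
    (hB : A.nbcBase 1 B) :
    (∀ i ∈ B, ∃ B', A.nbcBase 1 B' ∧ B.erase i ⊆ B' ∧ HArr.lexLt B' B) ↔
      A.betaNbcBase 1 B := by
  constructor
  · refine fun h => ⟨hB, fun i hi => ?_⟩
    obtain ⟨B', hB', hsub, hlex⟩ := h i hi
    have hcard : B'.card = (B.erase i).card + 1 := by
      rw [hB'.2.card_eq A hB.2, Finset.card_erase_add_one hi]
    obtain ⟨j, hj, rfl⟩ : ∃ j ∉ B.erase i, insert j (B.erase i) = B' :=
      (Finset.covBy_iff_exists_insert.1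
        (Finset.covBy_iff_card_sdiff_eq_one.2 ⟨hsub, by
          rw [Finset.card_sdiff_of_subset hsub]; omega⟩))
    refine ⟨j, ?_, hB'.2⟩
    rw [← Finset.insert_erase hi, Finset.erase_insert (Finset.notMem_erase i B)] at hlex
    exact (HArr.lexLt_insert_iff (Finset.notMem_erase i B) hj).1 hlex
  · rintro ⟨-, h⟩ i hi
    obtain ⟨j, hji, hj⟩ := h i hi
    obtain ⟨k, hki, hk, hnbc⟩ := A.exists_nbcBase_insert hB hi hji hj
    refine ⟨_, hnbc, Finset.subset_insert _ _, ?_⟩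
    have := HArr.lexLt_insert (Finset.notMem_erase i B) hk hki
    rwa [Finset.insert_erase hi] at this
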